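/- arXiv:1610.02270 — 4 statements merged into one kernel-verified Lean document; each statement's English description precedes it below -/
import Mathlib

section
/- Suppose the Schur complements T_1, …, T_J are all invertible. Then A = 𝓛𝓤, where 𝓛 is the block lower bidiagonal matrix with diagonal blocks T_1, …, T_J and subdiagonal blocks L_1, …, L_{J−1}, and 𝓤 is the block upper bidiagonal matrix whose diagonal blocks are identity matrices and whose superdiagonal blocks are T_1^{−1}U_1, …, T_{J−1}^{−1}U_{J−1}. In particular, A is invertible. -/
open Matrix

/-- The block tridiagonal matrix with diagonal blocks `D 0, …, D (J-1)`,
subdiagonal blocks `L 0, …, L (J-2)` and superdiagonal blocks `U 0, …, U (J-2)`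
(0-based indexing of the blocks `1, …, J` of the paper). -/
noncomputable def blockTri (n : ℕ → ℕ)
    (D : ∀ j : ℕ, Matrix (Fin (n j)) (Fin (n j)) ℂ)
    (L : ∀ j : ℕ, Matrix (Fin (n (j + 1))) (Fin (n j)) ℂ)
    (U : ∀ j : ℕ, Matrix (Fin (n j)) (Fin (n (j + 1))) ℂ)
    (J : ℕ) :
    Matrix ((j : Fin J) × Fin (n j.val)) ((j : Fin J) × Fin (n j.val)) ℂ :=
  Matrix.of fun p q =>
    if h : (p.1 : ℕ) = (q.1 : ℕ) then
      D (p.1 : ℕ) p.2 (Fin.cast (congrArg n h.symm) q.2)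
    else if h2 : (q.1 : ℕ) = (p.1 : ℕ) + 1 then
      U (p.1 : ℕ) p.2 (Fin.cast (congrArg n h2) q.2)
    else if h3 : (p.1 : ℕ) = (q.1 : ℕ) + 1 then
      L (q.1 : ℕ) (Fin.cast (congrArg n h3) p.2) q.2
    else 0

/-- The Schur complements `T_1 = D_1`, `T_j = D_j - L_{j-1} T_{j-1}⁻¹ U_{j-1}`
(0-based indexing). -/
noncomputable def schurT (n : ℕ → ℕ)
    (D : ∀ j : ℕ, Matrix (Fin (n j)) (Fin (n j)) ℂ)
    (L : ∀ j : ℕ, Matrix (Fin (n (j + 1))) (Fin (n j)) ℂ)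
    (U : ∀ j : ℕ, Matrix (Fin (n j)) (Fin (n (j + 1))) ℂ) :
    ∀ j : ℕ, Matrix (Fin (n j)) (Fin (n j)) ℂ
  | 0 => D 0
  | j + 1 => D (j + 1) - L j * (schurT n D L U j)⁻¹ * U j

/-- The block lower bidiagonal factor `𝓛` with diagonal blocks `T_j` and
subdiagonal blocks `L_j`. -/
noncomputable def blockLow (n : ℕ → ℕ)
    (D : ∀ j : ℕ, Matrix (Fin (n j)) (Fin (n j)) ℂ)
    (L : ∀ j : ℕ, Matrix (Fin (n (j + 1))) (Fin (n j)) ℂ)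
    (U : ∀ j : ℕ, Matrix (Fin (n j)) (Fin (n (j + 1))) ℂ)
    (J : ℕ) :
    Matrix ((j : Fin J) × Fin (n j.val)) ((j : Fin J) × Fin (n j.val)) ℂ :=
  Matrix.of fun p q =>
    if h : (p.1 : ℕ) = (q.1 : ℕ) then
      schurT n D L U (p.1 : ℕ) p.2 (Fin.cast (congrArg n h.symm) q.2)
    else if h3 : (p.1 : ℕ) = (q.1 : ℕ) + 1 then
      L (q.1 : ℕ) (Fin.cast (congrArg n h3) p.2) q.2
    else 0

/-- The block upper bidiagonal factor `𝓤` with identity diagonal blocks and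
superdiagonal blocks `T_j⁻¹ U_j`. -/
noncomputable def blockUp (n : ℕ → ℕ)
    (D : ∀ j : ℕ, Matrix (Fin (n j)) (Fin (n j)) ℂ)
    (L : ∀ j : ℕ, Matrix (Fin (n (j + 1))) (Fin (n j)) ℂ)
    (U : ∀ j : ℕ, Matrix (Fin (n j)) (Fin (n (j + 1))) ℂ)
    (J : ℕ) :
    Matrix ((j : Fin J) × Fin (n j.val)) ((j : Fin J) × Fin (n j.val)) ℂ :=
  Matrix.of fun p q =>
    if h : (p.1 : ℕ) = (q.1 : ℕ) then
      (1 : Matrix (Fin (n (p.1 : ℕ))) (Fin (n (p.1 : ℕ))) ℂ) p.2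
        (Fin.cast (congrArg n h.symm) q.2)
    else if h2 : (q.1 : ℕ) = (p.1 : ℕ) + 1 then
      ((schurT n D L U (p.1 : ℕ))⁻¹ * U (p.1 : ℕ)) p.2 (Fin.cast (congrArg n h2) q.2)
    else 0

/-- A matrix indexed by a sigma type that is block upper triangular for `Sigma.fst` has
determinant the product of the determinants of its diagonal blocks. -/
theorem det_sigma_of_blockTriangular {R ι : Type*} {m : ι → Type*} [CommRing R] [LinearOrder ι]
    [Fintype ι] [∀ i, Fintype (m i)] [∀ i, DecidableEq (m i)]
    {M : Matrix ((i : ι) × m i) ((i : ι) × m i) R} (hM : M.BlockTriangular Sigma.fst) :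
    M.det = ∏ i, (M.submatrix (Sigma.mk i) (Sigma.mk i)).det := by
  rw [hM.det_fintype]
  refine Finset.prod_congr rfl fun i _ => ?_
  rw [← Matrix.det_submatrix_equiv_self (Equiv.sigmaSubtype i).symm]
  rfl

section

variable (n : ℕ → ℕ) (D : ∀ j : ℕ, Matrix (Fin (n j)) (Fin (n j)) ℂ)
  (L : ∀ j : ℕ, Matrix (Fin (n (j + 1))) (Fin (n j)) ℂ)
  (U : ∀ j : ℕ, Matrix (Fin (n j)) (Fin (n (j + 1))) ℂ) {J : ℕ}

theorem det_blockLow : (blockLow n D L U J).det = ∏ i : Fin J, (schurT n D L U i).det := by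
  rw [← Matrix.det_transpose, det_sigma_of_blockTriangular]
  · refine Finset.prod_congr rfl fun i _ => ?_
    rw [← Matrix.det_transpose]
    congr 1
    ext a b
    simp [blockLow]
  · rintro ⟨i, a⟩ ⟨j, b⟩ (h : j.val < i.val)
    simp only [blockLow, Matrix.transpose_apply, Matrix.of_apply]
    rw [dif_neg (by omega), dif_neg (by omega)]

theorem det_blockUp : (blockUp n D L U J).det = 1 := by
  rw [det_sigma_of_blockTriangular]
  · refine Finset.prod_eq_one fun i _ => ?_
    rw [← Matrix.det_one (n := Fin (n i))]
    congr 1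
    ext a b
    simp only [blockUp, Matrix.submatrix_apply, Matrix.of_apply, dite_true]
    rfl
  · rintro ⟨i, a⟩ ⟨j, b⟩ (h : j.val < i.val)
    simp only [blockUp, Matrix.of_apply]
    rw [dif_neg (by omega), dif_neg (by omega)]

theorem blockLow_mulVec_zero (v : (j : Fin J) × Fin (n j.val) → ℂ) (h : 0 < J)
    (a : Fin (n 0)) :
    (blockLow n D L U J *ᵥ v) ⟨⟨0, h⟩, a⟩ = (D 0 *ᵥ fun c => v ⟨⟨0, h⟩, c⟩) a := by
  simp only [Matrix.mulVec, dotProduct, Fintype.sum_sigma]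
  rw [Finset.sum_eq_single ⟨0, h⟩]
  · simp [blockLow, schurT]
  · rintro ⟨k, hk⟩ - hne
    have hk0 : k ≠ 0 := by simpa using hne
    simp [blockLow, hk0.symm]
  · simp

theorem blockLow_mulVec_succ (v : (j : Fin J) × Fin (n j.val) → ℂ) (i : ℕ) (h : i + 1 < J)
    (a : Fin (n (i + 1))) :
    (blockLow n D L U J *ᵥ v) ⟨⟨i + 1, h⟩, a⟩ =
      (schurT n D L U (i + 1) *ᵥ fun c => v ⟨⟨i + 1, h⟩, c⟩) a +
        (L i *ᵥ fun c => v ⟨⟨i, by omega⟩, c⟩) a := by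
  simp only [Matrix.mulVec, dotProduct, Fintype.sum_sigma]
  rw [Fintype.sum_eq_add ⟨i + 1, h⟩ ⟨i, Nat.lt_of_succ_lt h⟩ (by simp)]
  · simp [blockLow]
  · rintro ⟨k, hk⟩ ⟨h₁, h₂⟩
    have h₁ : i + 1 ≠ k := by simpa [eq_comm] using h₁
    have h₂ : i ≠ k := by simpa [eq_comm] using h₂
    simp [blockLow, h₁, h₂]

theorem blockUp_self (i : ℕ) (h : i < J) (b : Fin (n i)) :
    (fun c => blockUp n D L U J ⟨⟨i, h⟩, c⟩ ⟨⟨i, h⟩, b⟩) = Pi.single b 1 := by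
  ext c
  simp [blockUp, Matrix.one_apply, Pi.single_apply]

theorem blockUp_succ (i : ℕ) (h : i + 1 < J) (b : Fin (n (i + 1))) :
    (fun c => blockUp n D L U J ⟨⟨i, by omega⟩, c⟩ ⟨⟨i + 1, h⟩, b⟩) =
      ((schurT n D L U i)⁻¹ * U i).col b := by
  ext c
  simp [blockUp]

theorem blockUp_of_ne {i j : ℕ} (hi : i < J) (hj : j < J) (h : j ≠ i) (h' : j ≠ i + 1)
    (b : Fin (n j)) :
    (fun c => blockUp n D L U J ⟨⟨i, hi⟩, c⟩ ⟨⟨j, hj⟩, b⟩) = 0 := by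
  ext c
  simp [blockUp, h.symm, h']

theorem blockTri_eq_blockLow_mul_blockUp (hT : ∀ j < J, IsUnit (schurT n D L U j)) :
    blockTri n D L U J = blockLow n D L U J * blockUp n D L U J := by
  have mulVec_col {l m k : ℕ} (M : Matrix (Fin l) (Fin m) ℂ) (N : Matrix (Fin m) (Fin k) ℂ)
      (b : Fin k) : M *ᵥ N.col b = (M * N).col b := rfl
  have cancel (j : ℕ) (hj : j < J) :
      schurT n D L U j * ((schurT n D L U j)⁻¹ * U j) = U j :=
    Matrix.mul_nonsing_inv_cancel_left _ _ ((Matrix.isUnit_iff_isUnit_det _).1 (hT j hj))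
  ext ⟨⟨i, hi⟩, a⟩ ⟨⟨j, hj⟩, b⟩
  change _ = (blockLow n D L U J *ᵥ fun p => blockUp n D L U J p ⟨⟨j, hj⟩, b⟩) _
  rcases i with _ | i
  · rw [blockLow_mulVec_zero]
    by_cases h0 : j = 0
    · subst h0
      rw [blockUp_self]
      simp [blockTri]
    by_cases h1 : j = 0 + 1
    · subst h1
      rw [blockUp_succ, mulVec_col]
      have := cancel 0 hi
      rw [schurT] at this ⊢
      rw [this]
      simp [blockTri]
    rw [blockUp_of_ne n D L U hi hj h0 h1]
    simp only [zero_add] at h1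
    simp [blockTri, Ne.symm h0, h1]
  · rw [blockLow_mulVec_succ]
    by_cases h0 : j = i + 1
    · subst h0
      rw [blockUp_self, blockUp_succ, mulVec_col]
      simp [blockTri, schurT, Matrix.mul_assoc]
    by_cases h1 : j = i + 1 + 1
    · subst h1
      rw [blockUp_succ, mulVec_col, cancel _ hi, blockUp_of_ne n D L U _ hj (by omega) (by omega)]
      simp [blockTri]
    rw [blockUp_of_ne n D L U hi hj h0 h1]
    by_cases h2 : j = i
    · subst h2
      rw [blockUp_self]
      simp [blockTri, h1]
    rw [blockUp_of_ne n D L U _ hj h2 h0]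
    simp [blockTri, Ne.symm h0, h1, Ne.symm h2]

end

/-- If all the Schur complements `T_1, …, T_J` are invertible, then
`A = 𝓛 𝓤`, and in particular `A` is invertible. -/
theorem block_LU_factorization
    (J : ℕ) (hJ : 1 ≤ J) (n : ℕ → ℕ)
    (D : ∀ j : ℕ, Matrix (Fin (n j)) (Fin (n j)) ℂ)
    (L : ∀ j : ℕ, Matrix (Fin (n (j + 1))) (Fin (n j)) ℂ)
    (U : ∀ j : ℕ, Matrix (Fin (n j)) (Fin (n (j + 1))) ℂ)
    (hT : ∀ j < J, IsUnit (schurT n D L U j)) :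
    blockTri n D L U J = blockLow n D L U J * blockUp n D L U J ∧
      IsUnit (blockTri n D L U J) := by
  have hA := blockTri_eq_blockLow_mul_blockUp n D L U hT
  refine ⟨hA, ?_⟩
  rw [hA, Matrix.isUnit_iff_isUnit_det, Matrix.det_mul, det_blockLow, det_blockUp, mul_one,
    isUnit_iff_ne_zero, Finset.prod_ne_zero_iff]
  exact fun i _ => ((Matrix.isUnit_iff_isUnit_det _).1 (hT i i.isLt)).ne_zero
end

section
/- Fix 1 ≤ j ≤ J and suppose the Schur complements T_1, …, T_j are invertible. Then A_{1:j} is invertible and the last diagonal block (i.e., the n_j × n_j block in block position (j, j)) of the inverse A_{1:j}^{−1} equals T_j^{−1}. -/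
open Matrix

/-- Splits the index set of the first `m + 1` blocks into the first `m` blocks and the last one. -/
noncomputable def sigmaFinSuccEquiv (n : ℕ → ℕ) (m : ℕ) :
    ((j : Fin m) × Fin (n j.val)) ⊕ Fin (n m) ≃ ((j : Fin (m + 1)) × Fin (n j.val)) :=
  Equiv.ofBijective
    (Sum.elim (fun p => ⟨p.1.castSucc, p.2⟩) (fun a => ⟨⟨m, Nat.lt_succ_self m⟩, a⟩)) (by
      constructor
      · rintro (⟨⟨i, hi⟩, x⟩ | x) (⟨⟨k, hk⟩, y⟩ | y) h
        · simp only [Sum.elim_inl, Fin.castSucc_mk, Sigma.mk.injEq, Fin.mk.injEq] at h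
          obtain ⟨rfl, h⟩ := h
          rw [eq_of_heq h]
        · simp only [Sum.elim_inl, Sum.elim_inr, Fin.castSucc_mk, Sigma.mk.injEq,
            Fin.mk.injEq] at h
          omega
        · simp only [Sum.elim_inl, Sum.elim_inr, Fin.castSucc_mk, Sigma.mk.injEq,
            Fin.mk.injEq] at h
          omega
        · simpa using h
      · rintro ⟨⟨i, hi⟩, x⟩
        rcases Nat.lt_succ_iff_lt_or_eq.mp hi with h | rfl
        · exact ⟨Sum.inl ⟨⟨i, h⟩, x⟩, rfl⟩
        · exact ⟨Sum.inr x, rfl⟩)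

@[simp]
theorem sigmaFinSuccEquiv_inl (n : ℕ → ℕ) (m : ℕ) (p : (j : Fin m) × Fin (n j.val)) :
    sigmaFinSuccEquiv n m (Sum.inl p) = ⟨p.1.castSucc, p.2⟩ := rfl

@[simp]
theorem sigmaFinSuccEquiv_inr (n : ℕ → ℕ) (m : ℕ) (a : Fin (n m)) :
    sigmaFinSuccEquiv n m (Sum.inr a) = ⟨⟨m, Nat.lt_succ_self m⟩, a⟩ := rfl

/-- If the leading block of a `2 × 2` block matrix and its Schur complement are invertible, then
the matrix is invertible and the trailing block of its inverse is the inverse of the Schur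
complement. -/
theorem isUnit_and_toBlocks₂₂_inv_of_isUnit_schur {l m R : Type*} [Fintype l] [Fintype m]
    [DecidableEq l] [DecidableEq m] [CommRing R] (M : Matrix (l ⊕ m) (l ⊕ m) R)
    (h₁ : IsUnit M.toBlocks₁₁)
    (h₂ : IsUnit (M.toBlocks₂₂ - M.toBlocks₂₁ * M.toBlocks₁₁⁻¹ * M.toBlocks₁₂)) :
    IsUnit M ∧ M⁻¹.toBlocks₂₂ =
      (M.toBlocks₂₂ - M.toBlocks₂₁ * M.toBlocks₁₁⁻¹ * M.toBlocks₁₂)⁻¹ := by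
  obtain ⟨A, B, C, D, rfl⟩ : ∃ A B C D, M = fromBlocks A B C D :=
    ⟨_, _, _, _, (fromBlocks_toBlocks M).symm⟩
  simp only [toBlocks_fromBlocks₁₁, toBlocks_fromBlocks₁₂, toBlocks_fromBlocks₂₁,
    toBlocks_fromBlocks₂₂] at h₁ h₂ ⊢
  let := h₁.invertible
  rw [← invOf_eq_nonsing_inv A] at h₂ ⊢
  let := h₂.invertible
  let := fromBlocks₁₁Invertible A B C D
  refine ⟨isUnit_of_invertible _, ?_⟩
  rw [← invOf_eq_nonsing_inv (fromBlocks A B C D), invOf_fromBlocks₁₁_eq,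
    toBlocks_fromBlocks₂₂, invOf_eq_nonsing_inv]

section BlockTri

variable (n : ℕ → ℕ) (D : ∀ j : ℕ, Matrix (Fin (n j)) (Fin (n j)) ℂ)
  (L : ∀ j : ℕ, Matrix (Fin (n (j + 1))) (Fin (n j)) ℂ)
  (U : ∀ j : ℕ, Matrix (Fin (n j)) (Fin (n (j + 1))) ℂ)

/-- The block tridiagonal matrix, with the last block separated from the others. -/
noncomputable def blockTriSplit (m : ℕ) :
    Matrix (((j : Fin m) × Fin (n j.val)) ⊕ Fin (n m))
      (((j : Fin m) × Fin (n j.val)) ⊕ Fin (n m)) ℂ :=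
  (blockTri n D L U (m + 1)).submatrix (sigmaFinSuccEquiv n m) (sigmaFinSuccEquiv n m)

theorem toBlocks₁₁_blockTriSplit (m : ℕ) :
    (blockTriSplit n D L U m).toBlocks₁₁ = blockTri n D L U m := rfl

theorem toBlocks₂₂_blockTriSplit (m : ℕ) : (blockTriSplit n D L U m).toBlocks₂₂ = D m := by
  ext a b
  simp [blockTriSplit, toBlocks₂₂, blockTri]

theorem toBlocks₂₁_blockTriSplit_succ (k : ℕ) :
    (blockTriSplit n D L U (k + 1)).toBlocks₂₁ =
      (fromCols 0 (L k)).submatrix id (sigmaFinSuccEquiv n k).symm := by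
  ext a p
  obtain ⟨(q | c), rfl⟩ := (sigmaFinSuccEquiv n k).surjective p
  · have := q.1.isLt
    rw [submatrix_apply, Equiv.symm_apply_apply]
    simp [blockTriSplit, toBlocks₂₁, blockTri]
    grind
  · rw [submatrix_apply, Equiv.symm_apply_apply]
    simp [blockTriSplit, toBlocks₂₁, blockTri]
    omega

theorem toBlocks₁₂_blockTriSplit_succ (k : ℕ) :
    (blockTriSplit n D L U (k + 1)).toBlocks₁₂ =
      (fromRows 0 (U k)).submatrix (sigmaFinSuccEquiv n k).symm id := by
  ext p a
  obtain ⟨(q | c), rfl⟩ := (sigmaFinSuccEquiv n k).surjective p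
  · have := q.1.isLt
    rw [submatrix_apply, Equiv.symm_apply_apply]
    simp [blockTriSplit, toBlocks₁₂, blockTri]
    grind
  · rw [submatrix_apply, Equiv.symm_apply_apply]
    simp [blockTriSplit, toBlocks₁₂, blockTri]

/-- A product `C * M * B` in which `C` and `B` are supported on the last block only sees the
trailing block of `M`. -/
theorem fromCols_zero_mul_mul_fromRows_zero {l m p q R : Type*} [Fintype l] [Fintype m]
    [CommRing R] (M : Matrix (l ⊕ m) (l ⊕ m) R) (C : Matrix p m R) (B : Matrix m q R) :
    fromCols (0 : Matrix p l R) C * M * fromRows (0 : Matrix l q R) B = C * M.toBlocks₂₂ * B := by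
  rw [← fromBlocks_toBlocks M, fromCols_mul_fromBlocks, fromCols_mul_fromRows]
  simp

/-- Invertibility of the Schur complements `T_0, …, T_j` makes the leading submatrix invertible,
and the last diagonal block of the inverse is `T_j⁻¹`. -/
theorem isUnit_blockTriSplit_and_toBlocks₂₂_inv (j : ℕ)
    (hT : ∀ i ≤ j, IsUnit (schurT n D L U i)) :
    IsUnit (blockTriSplit n D L U j) ∧
      (blockTriSplit n D L U j)⁻¹.toBlocks₂₂ = (schurT n D L U j)⁻¹ := by
  induction j with
  | zero =>
    have hS : (blockTriSplit n D L U 0).toBlocks₂₂ - (blockTriSplit n D L U 0).toBlocks₂₁ *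
        (blockTriSplit n D L U 0).toBlocks₁₁⁻¹ * (blockTriSplit n D L U 0).toBlocks₁₂ =
        schurT n D L U 0 := by
      rw [toBlocks₂₂_blockTriSplit, schurT, sub_eq_self]
      ext a b
      simp [mul_apply]
    rw [← hS]
    exact isUnit_and_toBlocks₂₂_inv_of_isUnit_schur _ (isUnit_of_subsingleton _)
      (hS ▸ hT 0 le_rfl)
  | succ k ih =>
    obtain ⟨hu, hinv⟩ := ih fun i hi => hT i (hi.trans k.le_succ)
    have hS : (blockTriSplit n D L U (k + 1)).toBlocks₂₂ -
        (blockTriSplit n D L U (k + 1)).toBlocks₂₁ *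
        (blockTriSplit n D L U (k + 1)).toBlocks₁₁⁻¹ *
        (blockTriSplit n D L U (k + 1)).toBlocks₁₂ = schurT n D L U (k + 1) := by
      have hA : (blockTri n D L U (k + 1))⁻¹ = (blockTriSplit n D L U k)⁻¹.submatrix
          (sigmaFinSuccEquiv n k).symm (sigmaFinSuccEquiv n k).symm := by
        rw [← inv_submatrix_equiv]
        simp [blockTriSplit]
      rw [toBlocks₂₂_blockTriSplit, toBlocks₁₁_blockTriSplit, toBlocks₂₁_blockTriSplit_succ,
        toBlocks₁₂_blockTriSplit_succ, hA, submatrix_mul_equiv, submatrix_mul_equiv,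
        fromCols_zero_mul_mul_fromRows_zero, hinv, submatrix_id_id, schurT]
    rw [← hS]
    refine isUnit_and_toBlocks₂₂_inv_of_isUnit_schur _ ?_ (hS ▸ hT _ le_rfl)
    rw [toBlocks₁₁_blockTriSplit]
    exact (isUnit_submatrix_equiv (A := blockTri n D L U (k + 1)) _ _).mp hu

end BlockTri

/-- For `1 ≤ j ≤ J` (here the block with 0-based index `j`), if `T_1, …, T_j`
are invertible then the leading principal block tridiagonal submatrix `A_{1:j}`
is invertible and the last diagonal block of its inverse equals `T_j⁻¹`. -/
theorem inv_last_diagonal_block_eq_schur_inv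
    (J : ℕ) (n : ℕ → ℕ)
    (D : ∀ j : ℕ, Matrix (Fin (n j)) (Fin (n j)) ℂ)
    (L : ∀ j : ℕ, Matrix (Fin (n (j + 1))) (Fin (n j)) ℂ)
    (U : ∀ j : ℕ, Matrix (Fin (n j)) (Fin (n (j + 1))) ℂ)
    (j : ℕ) (hj : j < J)
    (hT : ∀ i ≤ j, IsUnit (schurT n D L U i)) :
    IsUnit (blockTri n D L U (j + 1)) ∧
      ∀ a b : Fin (n j),
        (blockTri n D L U (j + 1))⁻¹ ⟨⟨j, Nat.lt_succ_self j⟩, a⟩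
            ⟨⟨j, Nat.lt_succ_self j⟩, b⟩ =
          (schurT n D L U j)⁻¹ a b := by
  obtain ⟨hu, hinv⟩ := isUnit_blockTriSplit_and_toBlocks₂₂_inv n D L U j hT
  refine ⟨(isUnit_submatrix_equiv _ _).mp hu, fun a b => ?_⟩
  rw [← hinv, blockTriSplit, inv_submatrix_equiv]
  rfl
end

section
/- Let A and M be invertible N × N complex matrices, and let R be an r × N complex matrix such that R Rᵀ = I_r and (I_N − Rᵀ R)(I_N − A M^{−1}) = 0. Then: (i) the r × r matrix R A M^{−1} Rᵀ is invertible; and (ii) for every f ∈ ℂ^N and every u⁰ ∈ ℂ^N satisfying (I_N − Rᵀ R)(f − A u⁰) = 0, if ρ ∈ ℂ^r solves (R A M^{−1} Rᵀ) ρ = R (f − A u⁰), then the vector u := M^{−1} Rᵀ ρ + u⁰ satisfies A u = f. -/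
open Matrix

/-- If `(1 - Rᵀ R)(1 - B) = 0` and `R Rᵀ = 1`, then `B` maps the range of `Rᵀ` into itself,
where it acts as `R B Rᵀ`. -/
theorem mul_transpose_eq_transpose_mul_of_residual {m n α : Type*} [Fintype m] [Fintype n]
    [DecidableEq m] [DecidableEq n] [Ring α] {B : Matrix n n α} {R : Matrix m n α}
    (hRR : R * Rᵀ = 1) (hres : (1 - Rᵀ * R) * (1 - B) = 0) :
    B * Rᵀ = Rᵀ * (R * B * Rᵀ) := by
  have hcomp : (1 - Rᵀ * R) * B = 1 - Rᵀ * R := by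
    rw [mul_sub, mul_one, sub_eq_zero] at hres
    exact hres.symm
  have hzero : (1 - Rᵀ * R) * B * Rᵀ = 0 := by
    rw [hcomp, Matrix.sub_mul, Matrix.one_mul, Matrix.mul_assoc, hRR, Matrix.mul_one, sub_self]
  rw [Matrix.sub_mul, Matrix.sub_mul, Matrix.one_mul, sub_eq_zero] at hzero
  simpa only [Matrix.mul_assoc] using hzero

/-- Residual substructuring: let `A` and `M` be invertible `N × N` matrices and
`R` an `r × N` matrix with `R Rᵀ = I` and `(I - Rᵀ R)(I - A M⁻¹) = 0`.  Then the
substructured matrix `R A M⁻¹ Rᵀ` is invertible, and for every `f` and every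
initial guess `u⁰` whose residual is supported on the rows selected by `R`, if
`ρ` solves `(R A M⁻¹ Rᵀ) ρ = R (f - A u⁰)`, then `u = M⁻¹ Rᵀ ρ + u⁰` solves
`A u = f`. -/
theorem residual_substructuring
    (N r : ℕ)
    (A M : Matrix (Fin N) (Fin N) ℂ)
    (hA : IsUnit A) (hM : IsUnit M)
    (R : Matrix (Fin r) (Fin N) ℂ)
    (hRR : R * Rᵀ = 1)
    (hres : (1 - Rᵀ * R) * (1 - A * M⁻¹) = 0) :
    IsUnit (R * A * M⁻¹ * Rᵀ) ∧
      ∀ (f u0 : Fin N → ℂ) (ρ : Fin r → ℂ),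
        (1 - Rᵀ * R).mulVec (f - A.mulVec u0) = 0 →
        (R * A * M⁻¹ * Rᵀ).mulVec ρ = R.mulVec (f - A.mulVec u0) →
        A.mulVec (M⁻¹.mulVec (Rᵀ.mulVec ρ) + u0) = f := by
  have hrange : A * M⁻¹ * Rᵀ = Rᵀ * (R * A * M⁻¹ * Rᵀ) := by
    simpa only [Matrix.mul_assoc] using mul_transpose_eq_transpose_mul_of_residual hRR hres
  have hinv : M * A⁻¹ * (A * M⁻¹) = 1 := by
    rw [Matrix.mul_assoc, Matrix.nonsing_inv_mul_cancel_left A _ (A.isUnit_iff_isUnit_det.mp hA),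
      Matrix.mul_nonsing_inv M (M.isUnit_iff_isUnit_det.mp hM)]
  refine ⟨?_, fun f u0 ρ hu0 hρ => ?_⟩
  · refine .of_mul_eq_one_right (R * (M * A⁻¹) * Rᵀ) ?_
    rw [Matrix.mul_assoc, ← hrange, Matrix.mul_assoc, ← Matrix.mul_assoc (M * A⁻¹), hinv,
      Matrix.one_mul, hRR]
  · rw [sub_mulVec, one_mulVec, sub_eq_zero] at hu0
    rw [mulVec_add, mulVec_mulVec, mulVec_mulVec, hrange, ← mulVec_mulVec, hρ,
      mulVec_mulVec, ← hu0, sub_add_cancel]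
end

section
/- Let A be an N × N complex matrix with Aᵀ = A. For j = 1, …, J let R_j be an N_j × N complex matrix, let A_j be an invertible N_j × N_j complex matrix with A_jᵀ = A_j, and let Φ_j be an N_j × N_j complex matrix with Φ_jᵀ = Φ_j. Define the RAS-type preconditioner B_RAS := Σ_{j=1}^J R_jᵀ Φ_j A_j^{−1} R_j and the ASH-type preconditioner B_ASH := Σ_{j=1}^J R_jᵀ A_j^{−1} Φ_j R_j. Then (B_ASH A)ᵀ = A B_RAS, and the spectra coincide: spectrum(B_ASH A) = spectrum(B_RAS A). -/
open Matrix

/-- For a complex symmetric matrix `A`, complex symmetric invertible subdomain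
matrices `A_j`, and symmetric weighting matrices `Φ_j`, the RAS-type
preconditioner `B_RAS = Σ_j R_jᵀ Φ_j A_j⁻¹ R_j` and the ASH-type preconditioner
`B_ASH = Σ_j R_jᵀ A_j⁻¹ Φ_j R_j` satisfy `(B_ASH A)ᵀ = A B_RAS`, and the
preconditioned operators `B_ASH A` and `B_RAS A` have the same spectrum. -/
theorem ras_ash_transpose_and_spectrum
    (N J : ℕ)
    (A : Matrix (Fin N) (Fin N) ℂ) (hA : Aᵀ = A)
    (Nl : Fin J → ℕ)
    (R : ∀ j : Fin J, Matrix (Fin (Nl j)) (Fin N) ℂ)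
    (Asub : ∀ j : Fin J, Matrix (Fin (Nl j)) (Fin (Nl j)) ℂ)
    (hAsubUnit : ∀ j : Fin J, IsUnit (Asub j))
    (hAsubSym : ∀ j : Fin J, (Asub j)ᵀ = Asub j)
    (Φ : ∀ j : Fin J, Matrix (Fin (Nl j)) (Fin (Nl j)) ℂ)
    (hΦ : ∀ j : Fin J, (Φ j)ᵀ = Φ j) :
    ((∑ j : Fin J, (R j)ᵀ * (Asub j)⁻¹ * Φ j * R j) * A)ᵀ =
        A * (∑ j : Fin J, (R j)ᵀ * Φ j * (Asub j)⁻¹ * R j) ∧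
      spectrum ℂ ((∑ j : Fin J, (R j)ᵀ * (Asub j)⁻¹ * Φ j * R j) * A) =
        spectrum ℂ ((∑ j : Fin J, (R j)ᵀ * Φ j * (Asub j)⁻¹ * R j) * A) := by
  have htranspose : ((∑ j : Fin J, (R j)ᵀ * (Asub j)⁻¹ * Φ j * R j) * A)ᵀ =
      A * (∑ j : Fin J, (R j)ᵀ * Φ j * (Asub j)⁻¹ * R j) := by
    simp only [transpose_mul, transpose_sum, transpose_transpose, transpose_nonsing_inv,
      hA, hAsubSym, hΦ, Matrix.mul_assoc]
  refine ⟨htranspose, ?_⟩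
  ext μ
  rw [mem_spectrum_iff_isRoot_charpoly, mem_spectrum_iff_isRoot_charpoly,
    ← charpoly_transpose, htranspose, charpoly_mul_comm]
end
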